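/- Let w : ℝ → ℝ be an even Schwartz function. For every ε > 0 there exists a constant C > 0, depending only on ε and w, such that for every positive integer N, every prime p, and every real X ≥ 1: (a) if p ∤ N, then |∑_{d ∈ ℤ, d squarefree, gcd(d,N)=1, p | d} w̃(d/X) − W(X)/(p+1)| ≤ C·(p²·X·N)^{ε}, where W(X) := ∑_{d ∈ ℤ, d squarefree, gcd(d,N)=1} w̃(d/X); and (b) if p | N, then ∑_{d ∈ ℤ, d squarefree, gcd(d,N)=1, p | d} w̃(d/X) = 0. -/

import Mathlib

open scoped Classical

/-- For a Schwartz function `w : ℝ → ℝ` and a positive integer `N`, the function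
`w̃(x) = ∑_{n ≥ 1, gcd(n,N) = 1} w(n² x)`. -/
noncomputable def wtilde (w : ℝ → ℝ) (N : ℕ) (x : ℝ) : ℝ :=
  ∑' n : ℕ, if 0 < n ∧ Nat.Coprime n N then w ((n : ℝ) ^ 2 * x) else 0

open MeasureTheory

/-- Sum of `w (m / Y)` over the integers in `A`. -/
noncomputable def TA (w : SchwartzMap ℝ ℝ) (A : Set ℤ) (Y : ℝ) : ℝ :=
  ∑' m : ℤ, A.indicator (fun m : ℤ => w ((m : ℝ) / Y)) m

/-- Nonzero integers divisible by no element of `s`. -/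
def As (s : Finset ℕ) : Set ℤ := {m | m ≠ 0 ∧ ∀ q ∈ s, ¬ (q : ℤ) ∣ m}

/-- Dilation of a set. -/
def dil (q : ℕ) (A : Set ℤ) : Set ℤ := {m | ∃ k ∈ A, m = (q : ℤ) * k}

theorem decay2 (w : SchwartzMap ℝ ℝ) : ∃ K : ℝ, 0 < K ∧ ∀ (A : Set ℤ), (0 : ℤ) ∉ A →
    ∀ Y : ℝ, 0 < Y → ∀ m : ℤ,
      ‖A.indicator (fun m : ℤ => w ((m : ℝ) / Y)) m‖ ≤ K * Y ^ 2 * (1 / (m : ℝ) ^ 2) := by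
  obtain ⟨K, hK, h⟩ := w.decay 2 0
  refine ⟨K, hK, fun A hA Y hY m => ?_⟩
  by_cases hm : m ∈ A
  · have hm0 : m ≠ 0 := fun h0 => hA (h0 ▸ hm)
    have hm0' : (0 : ℝ) < (m : ℝ) ^ 2 := by positivity
    rw [Set.indicator_of_mem hm]
    have := h ((m : ℝ) / Y)
    rw [norm_iteratedFDeriv_zero, Real.norm_eq_abs (_ / _), sq_abs, div_pow, div_mul_eq_mul_div,
      div_le_iff₀ (by positivity)] at this
    rw [mul_one_div, le_div_iff₀ hm0']
    linarith
  · rw [Set.indicator_of_notMem hm, norm_zero]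
    positivity

theorem TA_summable (w : SchwartzMap ℝ ℝ) (A : Set ℤ) (hA : (0 : ℤ) ∉ A) (Y : ℝ) (hY : 0 < Y) :
    Summable (fun m : ℤ => A.indicator (fun m : ℤ => w ((m : ℝ) / Y)) m) := by
  obtain ⟨K, hK, h⟩ := decay2 w
  exact Summable.of_norm_bounded
    ((Real.summable_one_div_int_pow.mpr one_lt_two).mul_left (K * Y ^ 2)) (h A hA Y hY)

theorem TA_bound (w : SchwartzMap ℝ ℝ) : ∃ K : ℝ, 0 < K ∧ ∀ (A : Set ℤ), (0 : ℤ) ∉ A →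
    ∀ Y : ℝ, 0 < Y → Y ≤ 1 → |TA w A Y| ≤ K := by
  obtain ⟨K, hK, h⟩ := decay2 w
  have hs : Summable (fun m : ℤ => 1 / (m : ℝ) ^ 2) :=
    Real.summable_one_div_int_pow.mpr one_lt_two
  have h0 : 0 ≤ ∑' m : ℤ, 1 / (m : ℝ) ^ 2 := tsum_nonneg fun m => by positivity
  refine ⟨K * (∑' m : ℤ, 1 / (m : ℝ) ^ 2) + 1, by positivity, fun A hA Y hY hY1 => ?_⟩
  have h1 := tsum_of_norm_bounded (hs.hasSum.mul_left K) (fun m => (h A hA Y hY m).trans (?_ :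
    _ ≤ K * (1 / (m : ℝ) ^ 2)))
  · rw [Real.norm_eq_abs] at h1
    unfold TA
    linarith
  · gcongr
    have : Y ^ 2 ≤ 1 := pow_le_one₀ hY.le hY1
    nlinarith

theorem TA_dil (w : SchwartzMap ℝ ℝ) (A : Set ℤ) (Y : ℝ) (q : ℕ) (hq : 0 < q) :
    TA w (dil q A) Y = TA w A (Y / q) := by
  unfold TA
  have hq' : (q : ℤ) ≠ 0 := by positivity
  have hinj : Function.Injective (fun k : ℤ => (q : ℤ) * k) := mul_right_injective₀ hq'
  rw [← hinj.tsum_eq]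
  · congr 1
    ext k
    have : ((q : ℤ) * k ∈ dil q A) ↔ k ∈ A := by
      constructor
      · rintro ⟨k', hk', h⟩
        rwa [hinj h]
      · intro h
        exact ⟨k, h, rfl⟩
    by_cases hk : k ∈ A
    · rw [Set.indicator_of_mem hk, Set.indicator_of_mem (this.mpr hk)]
      congr 1
      push_cast
      rw [div_div_eq_mul_div, mul_comm]
    · rw [Set.indicator_of_notMem hk, Set.indicator_of_notMem (fun h => hk (this.mp h))]
  · intro m hm
    have : m ∈ dil q A := Set.mem_of_indicator_ne_zero hm
    obtain ⟨k, _, rfl⟩ := this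
    exact ⟨k, rfl⟩

theorem TA_union (w : SchwartzMap ℝ ℝ) (A B D : Set ℤ) (hA : (0 : ℤ) ∉ A) (hB : (0 : ℤ) ∉ B)
    (hd : Disjoint A B) (hD : D = A ∪ B) (Y : ℝ) (hY : 0 < Y) :
    TA w D Y = TA w A Y + TA w B Y := by
  unfold TA
  rw [← (TA_summable w A hA Y hY).tsum_add (TA_summable w B hB Y hY), hD]
  congr 1
  ext m
  rw [Set.indicator_union_of_disjoint hd]

theorem zero_notMem_As (s : Finset ℕ) : (0 : ℤ) ∉ As s := fun h => h.1 rfl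

theorem zero_notMem_dil (q : ℕ) (hq : 0 < q) (A : Set ℤ) (hA : (0 : ℤ) ∉ A) :
    (0 : ℤ) ∉ dil q A := by
  rintro ⟨k, hk, h⟩
  have hq' : (q : ℤ) ≠ 0 := by positivity
  rcases mul_eq_zero.mp h.symm with h | h
  · exact hq' h
  · exact hA (h ▸ hk)

theorem As_insert (s : Finset ℕ) (q : ℕ) (hq : q.Prime) (hqs : q ∉ s) (hs : ∀ r ∈ s, r.Prime) :
    Disjoint (As (insert q s)) (dil q (As s)) ∧ As s = As (insert q s) ∪ dil q (As s) := by
  have hq' : (q : ℤ) ≠ 0 := by exact_mod_cast hq.ne_zero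
  constructor
  · rw [Set.disjoint_left]
    rintro m hm ⟨k, hk, rfl⟩
    exact hm.2 q (Finset.mem_insert_self _ _) (dvd_mul_right _ _)
  · ext m
    constructor
    · rintro ⟨h0, h⟩
      by_cases hqm : (q : ℤ) ∣ m
      · right
        obtain ⟨k, rfl⟩ := hqm
        refine ⟨k, ⟨right_ne_zero_of_mul h0, fun r hr hrk => h r hr (hrk.mul_left _)⟩, rfl⟩
      · left
        refine ⟨h0, fun r hr => ?_⟩
        rcases Finset.mem_insert.mp hr with rfl | hr
        · exact hqm
        · exact h r hr
    · rintro (⟨h0, h⟩ | ⟨k, ⟨h0, h⟩, rfl⟩)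
      · exact ⟨h0, fun r hr => h r (Finset.mem_insert_of_mem hr)⟩
      · refine ⟨mul_ne_zero hq' h0, fun r hr hd => ?_⟩
        rcases (Nat.prime_iff_prime_int.mp (hs r hr)).dvd_or_dvd hd with h1 | h1
        · have := (Nat.prime_dvd_prime_iff_eq (hs r hr) hq).mp (by exact_mod_cast h1)
          exact hqs (this ▸ hr)
        · exact h r hr h1

/-- odd `p`-adic valuation part -/
def Bs (s : Finset ℕ) (p : ℕ) : Set ℤ := {m | m ∈ As s ∧ Odd (padicValInt p m)}

theorem Bs_dil (s : Finset ℕ) (p : ℕ) (hp : p.Prime) (hps : p ∉ s) (hs : ∀ r ∈ s, r.Prime) :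
    Disjoint (Bs s p) (dil p (Bs s p)) ∧ dil p (As s) = Bs s p ∪ dil p (Bs s p) := by
  have := Fact.mk hp
  have hp' : (p : ℤ) ≠ 0 := by exact_mod_cast hp.ne_zero
  have hv : ∀ k : ℤ, k ≠ 0 → padicValInt p ((p : ℤ) * k) = 1 + padicValInt p k := by
    intro k hk
    rw [padicValInt.mul hp' hk, padicValInt.self hp.one_lt]
  have hsub : dil p (As s) ⊆ As s := by
    rw [(As_insert s p hp hps hs).2]
    intro m hm
    right
    rwa [← (As_insert s p hp hps hs).2] at hm
  constructor
  · rw [Set.disjoint_left]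
    rintro m ⟨_, hm⟩ ⟨k, ⟨hk, hk2⟩, rfl⟩
    rw [hv k hk.1] at hm
    rw [Nat.odd_add] at hm
    exact (Nat.not_even_iff_odd.mpr hk2) (hm.mp odd_one)
  · ext m
    constructor
    · intro hm
      obtain ⟨k, hk, rfl⟩ := id hm
      by_cases ho : Odd (padicValInt p k)
      · right
        exact ⟨k, ⟨hk, ho⟩, rfl⟩
      · left
        refine ⟨hsub hm, ?_⟩
        rw [hv k hk.1]
        exact odd_one.add_even (Nat.not_odd_iff_even.mp ho)
    · rintro (⟨hm, ho⟩ | ⟨k, hk, rfl⟩)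
      · have : (p : ℤ) ∣ m := by
          by_contra hnd
          rw [padicValInt.eq_zero_of_not_dvd hnd] at ho
          exact absurd ho (by decide)
        obtain ⟨k, rfl⟩ := this
        exact ⟨k, ⟨right_ne_zero_of_mul hm.1, fun r hr hrk => hm.2 r hr (hrk.mul_left _)⟩, rfl⟩
      · exact ⟨k, hk.1, rfl⟩

theorem base_bound (w : SchwartzMap ℝ ℝ) (Y : ℝ) (hY : 0 < Y) :
    |TA w (As ∅) Y - (∫ x, w x) * Y| ≤ |w 0| + ∫ x, ‖SchwartzMap.derivCLM ℝ ℝ w x‖ := by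
  set g := SchwartzMap.derivCLM ℝ ℝ w with hg
  set f : ℝ → ℝ := fun x => w (x / Y) with hf
  set f' : ℝ → ℝ := fun x => g (x / Y) / Y with hf'
  have hfi : Integrable f := w.integrable.comp_div hY.ne'
  have hfi' : Integrable f' := (g.integrable.comp_div hY.ne').div_const Y
  have hder : ∀ x, HasDerivAt f (f' x) x := by
    intro x
    have h1 : HasDerivAt (fun x => x / Y) (1 / Y) x := (hasDerivAt_id x).div_const Y
    have h2 : HasDerivAt w (g (x / Y)) (x / Y) := by
      rw [hg, SchwartzMap.derivCLM_apply]
      exact w.differentiableAt.hasDerivAt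
    have := h2.comp x h1
    rw [mul_one_div] at this
    exact this
  have hI : ∫ x, f x = (∫ x, w x) * Y := by
    rw [hf, Measure.integral_comp_div (fun x => w x), abs_of_pos hY, smul_eq_mul, mul_comm]
  have hI' : ∫ x, ‖f' x‖ = ∫ x, ‖g x‖ := by
    have : (fun x => ‖f' x‖) = fun x => (fun y => ‖g y‖ / Y) (x / Y) := by
      ext x
      rw [hf', norm_div, Real.norm_of_nonneg hY.le]
    rw [this, Measure.integral_comp_div (fun y => ‖g y‖ / Y), abs_of_pos hY, smul_eq_mul,
      integral_div]
    field_simp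
  have hs1 := hfi.hasSum_intervalIntegral 0
  have hs2 := hfi'.norm.hasSum_intervalIntegral 0
  simp only [zero_add] at hs1 hs2
  -- full sum
  have hA := TA_summable w (As ∅) (zero_notMem_As _) Y hY
  have hsing : HasSum (fun m : ℤ => if m = 0 then w 0 else 0) (w 0) := hasSum_ite_eq 0 (w 0)
  have hfull : HasSum (fun m : ℤ => f m) (TA w (As ∅) Y + w 0) := by
    have hadd : HasSum _ (TA w (As ∅) Y + w 0) := hA.hasSum.add hsing
    convert hadd using 1
    ext m
    by_cases hm : m = 0
    · subst hm
      rw [Set.indicator_of_notMem (zero_notMem_As _)]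
      simp [hf]
    · rw [Set.indicator_of_mem (show m ∈ As ∅ from ⟨hm, by simp⟩)]
      simp [hf, hm]
  have hdiff := hfull.sub hs1
  have hb : ∀ m : ℤ, ‖f m - ∫ x in (m : ℝ)..(m : ℝ) + 1, f x‖ ≤
      ∫ x in (m : ℝ)..(m : ℝ) + 1, ‖f' x‖ := by
    intro m
    have hm1 : (m : ℝ) ≤ m + 1 := by linarith
    have e1 : f m - ∫ x in (m : ℝ)..(m : ℝ) + 1, f x
        = - ∫ x in (m : ℝ)..(m : ℝ) + 1, (f x - f m) := by
      rw [intervalIntegral.integral_sub hfi.intervalIntegrable (by simp)]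
      simp
    rw [e1, norm_neg]
    have := intervalIntegral.norm_integral_le_of_norm_le_const
      (a := (m : ℝ)) (b := m + 1) (C := ∫ x in (m : ℝ)..(m : ℝ) + 1, ‖f' x‖)
      (f := fun x => f x - f m) ?_
    · simpa using this
    · intro x hx
      rw [Set.uIoc_of_le hm1] at hx
      rw [← intervalIntegral.integral_eq_sub_of_hasDerivAt (fun y _ => hder y)
        hfi'.intervalIntegrable]
      refine (intervalIntegral.norm_integral_le_integral_norm hx.1.le).trans ?_
      exact intervalIntegral.integral_mono_interval le_rfl hx.1.le hx.2
        (Filter.Eventually.of_forall fun y => norm_nonneg _) hfi'.norm.intervalIntegrable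
  have hfin := tsum_of_norm_bounded hs2 hb
  rw [hdiff.tsum_eq, hI', hI, Real.norm_eq_abs] at hfin
  have : TA w (As ∅) Y - (∫ x, w x) * Y = (TA w (As ∅) Y + w 0 - (∫ x, w x) * Y) - w 0 := by ring
  rw [this]
  refine (abs_sub _ _).trans ?_
  linarith

theorem W_bound (w : SchwartzMap ℝ ℝ) : ∃ C0 : ℝ, 0 < C0 ∧ ∀ s : Finset ℕ, (∀ r ∈ s, r.Prime) →
    ∃ c : ℝ, ∀ Y : ℝ, 0 < Y → |TA w (As s) Y - c * Y| ≤ C0 * 2 ^ s.card := by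
  have h0 : 0 ≤ |w 0| + ∫ x, ‖SchwartzMap.derivCLM ℝ ℝ w x‖ :=
    add_nonneg (abs_nonneg _) (integral_nonneg fun _ => norm_nonneg _)
  refine ⟨|w 0| + (∫ x, ‖SchwartzMap.derivCLM ℝ ℝ w x‖) + 1, by linarith, fun s => ?_⟩
  set C0 := |w 0| + (∫ x, ‖SchwartzMap.derivCLM ℝ ℝ w x‖) + 1
  induction s using Finset.induction_on with
  | empty =>
    intro _
    refine ⟨∫ x, w x, fun Y hY => ?_⟩
    have := base_bound w Y hY
    simp only [Finset.card_empty, pow_zero, mul_one]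
    linarith
  | insert q s hqs ih =>
    intro hs
    have hs' : ∀ r ∈ s, r.Prime := fun r hr => hs r (Finset.mem_insert_of_mem hr)
    have hq := hs q (Finset.mem_insert_self _ _)
    obtain ⟨c, hc⟩ := ih hs'
    refine ⟨c - c / q, fun Y hY => ?_⟩
    have hqp : (0 : ℝ) < q := by exact_mod_cast hq.pos
    obtain ⟨hd, hu⟩ := As_insert s q hq hqs hs'
    have e := TA_union w _ _ _ (zero_notMem_As _)
      (zero_notMem_dil q hq.pos _ (zero_notMem_As s)) hd hu Y hY
    rw [TA_dil w _ _ q hq.pos] at e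
    have b1 := hc Y hY
    have b2 := hc (Y / q) (by positivity)
    rw [Finset.card_insert_of_notMem hqs, pow_succ]
    have : TA w (As (insert q s)) Y - (c - c / q) * Y
        = (TA w (As s) Y - c * Y) - (TA w (As s) (Y / q) - c * (Y / q)) := by
      rw [e]; ring
    rw [this]
    refine (abs_sub _ _).trans ?_
    linarith

theorem E_bound (w : SchwartzMap ℝ ℝ) : ∃ D : ℝ, 0 < D ∧ ∀ s : Finset ℕ, (∀ r ∈ s, r.Prime) →
    ∀ p : ℕ, p.Prime → p ∉ s → ∀ k : ℕ, ∀ X : ℝ, 0 < X → X ≤ 2 ^ k →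
      |TA w (Bs s p) X - TA w (As s) X / ((p : ℝ) + 1)| ≤ D * 2 ^ s.card * (k + 2) := by
  obtain ⟨K, hK, hb⟩ := TA_bound w
  obtain ⟨C0, hC0, hW⟩ := W_bound w
  refine ⟨2 * K + C0, by positivity, fun s hs p hp hps => ?_⟩
  obtain ⟨c, hc⟩ := hW s hs
  have hpp : (0 : ℝ) < p := by exact_mod_cast hp.pos
  have hp2 : (2 : ℝ) ≤ p := by exact_mod_cast hp.two_le
  have h2s : (1 : ℝ) ≤ 2 ^ s.card := one_le_pow₀ (by norm_num)
  have hB0 : (0 : ℤ) ∉ Bs s p := fun h => zero_notMem_As s h.1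
  have hc1 : |c| ≤ K + C0 * 2 ^ s.card := by
    have h1 := hc 1 one_pos
    have h2 := hb (As s) (zero_notMem_As s) 1 one_pos le_rfl
    have : c = TA w (As s) 1 - (TA w (As s) 1 - c * 1) := by ring
    rw [this]
    exact (abs_sub _ _).trans (add_le_add h2 h1)
  obtain ⟨hd, hu⟩ := Bs_dil s p hp hps hs
  have key : ∀ k : ℕ, ∀ X : ℝ, 0 < X → X ≤ 2 ^ k →
      |TA w (Bs s p) X - c * X / ((p : ℝ) + 1)| ≤ (2 * K + C0) * 2 ^ s.card * (k + 1) := by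
    intro k
    induction k with
    | zero =>
      intro X hX hX1
      rw [pow_zero] at hX1
      have h1 := hb _ hB0 X hX hX1
      have h2 : |c * X / ((p : ℝ) + 1)| ≤ |c| := by
        rw [abs_div, abs_mul, abs_of_pos hX, abs_of_pos (by positivity : (0 : ℝ) < p + 1),
          div_le_iff₀ (by positivity)]
        have := abs_nonneg c
        nlinarith
      refine (abs_sub _ _).trans ?_
      push_cast
      nlinarith
    | succ k ih =>
      intro X hX hXk
      have hXp : X / p ≤ 2 ^ k := by
        rw [div_le_iff₀ hpp]
        rw [pow_succ] at hXk
        have : (0 : ℝ) < 2 ^ k := by positivity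
        nlinarith
      have h1 := ih (X / p) (by positivity) hXp
      have h2 := hc (X / p) (by positivity)
      have e := TA_union w _ _ _ hB0 (zero_notMem_dil p hp.pos _ hB0) hd hu X hX
      rw [TA_dil w _ _ p hp.pos, TA_dil w _ _ p hp.pos] at e
      have : TA w (Bs s p) X - c * X / ((p : ℝ) + 1) = (TA w (As s) (X / p) - c * (X / p))
          - (TA w (Bs s p) (X / p) - c * (X / p) / ((p : ℝ) + 1)) := by
        rw [e]
        field_simp
        ring
      rw [this]
      refine (abs_sub _ _).trans ?_
      push_cast
      nlinarith
  intro k X hX hXk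
  have h1 := key k X hX hXk
  have h2 := hc X hX
  have h3 : |(TA w (As s) X - c * X) / ((p : ℝ) + 1)| ≤ C0 * 2 ^ s.card := by
    rw [abs_div, abs_of_pos (by positivity : (0 : ℝ) < p + 1), div_le_iff₀ (by positivity)]
    have := abs_nonneg (TA w (As s) X - c * X)
    nlinarith
  have : TA w (Bs s p) X - TA w (As s) X / ((p : ℝ) + 1)
      = (TA w (Bs s p) X - c * X / ((p : ℝ) + 1)) - (TA w (As s) X - c * X) / ((p : ℝ) + 1) := by
    ring
  rw [this]
  refine (abs_sub _ _).trans ?_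
  nlinarith

theorem two_pow_omega (ε : ℝ) (hε : 0 < ε) : ∃ C : ℝ, 0 < C ∧ ∀ N : ℕ, 0 < N →
    (2 : ℝ) ^ N.primeFactors.card ≤ C * (N : ℝ) ^ ε := by
  obtain ⟨K, hK⟩ := exists_nat_gt ((2 : ℝ) ^ (1 / ε))
  refine ⟨2 ^ K, by positivity, fun N hN => ?_⟩
  have h1 : ∀ q : ℕ, K ≤ q → (2 : ℝ) ≤ (q : ℝ) ^ ε := by
    intro q hq
    have h : (2 : ℝ) ^ (1 / ε) ≤ q := hK.le.trans (by exact_mod_cast hq)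
    calc (2 : ℝ) = ((2 : ℝ) ^ (1 / ε)) ^ ε := by
          rw [← Real.rpow_mul (by norm_num), one_div_mul_cancel hε.ne', Real.rpow_one]
      _ ≤ _ := Real.rpow_le_rpow (by positivity) h hε.le
  have h2 : (2 : ℝ) ^ N.primeFactors.card ≤
      ∏ q ∈ N.primeFactors, ((if q < K then 2 else 1) * (q : ℝ) ^ ε) := by
    rw [← Finset.prod_const]
    refine Finset.prod_le_prod (fun _ _ => by norm_num) fun q hq => ?_
    have hq1 : (1 : ℝ) ≤ q := by exact_mod_cast (Nat.prime_of_mem_primeFactors hq).one_le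
    have := Real.one_le_rpow hq1 hε.le
    split_ifs with h
    · linarith
    · linarith [h1 q (not_lt.mp h)]
  refine h2.trans ?_
  rw [Finset.prod_mul_distrib]
  have h3 : ∏ q ∈ N.primeFactors, (if q < K then (2 : ℝ) else 1) ≤ 2 ^ K := by
    rw [Finset.prod_ite, Finset.prod_const, Finset.prod_const_one, mul_one]
    refine pow_le_pow_right₀ (by norm_num) ?_
    calc _ ≤ (Finset.range K).card := Finset.card_le_card fun q hq => by
            simpa using (Finset.mem_filter.mp hq).2
      _ = K := Finset.card_range K
  have h4 : ∏ q ∈ N.primeFactors, (q : ℝ) ^ ε ≤ (N : ℝ) ^ ε := by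
    rw [Real.finsetProd_rpow _ _ (fun _ _ => by positivity)]
    refine Real.rpow_le_rpow (Finset.prod_nonneg fun _ _ => by positivity) ?_ hε.le
    rw [← Nat.cast_prod]
    exact_mod_cast Nat.le_of_dvd hN (Nat.prod_primeFactors_dvd N)
  exact mul_le_mul h3 h4 (Finset.prod_nonneg fun _ _ => by positivity) (by positivity)

theorem log_part (ε : ℝ) (hε : 0 < ε) : ∃ C : ℝ, 0 < C ∧ ∀ X : ℝ, 1 ≤ X →
    ∃ k : ℕ, X ≤ 2 ^ k ∧ (k : ℝ) + 2 ≤ C * X ^ ε := by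
  have hl : 0 < Real.log 2 := Real.log_pos (by norm_num)
  refine ⟨3 + 1 / (ε * Real.log 2), by positivity, fun X hX => ?_⟩
  have hX0 : 0 < X := by linarith
  refine ⟨⌈Real.log X / Real.log 2⌉₊, ?_, ?_⟩
  · rw [← Real.log_le_log_iff hX0 (by positivity), Real.log_pow]
    exact (div_le_iff₀ hl).mp (Nat.le_ceil _)
  · have h1 := Nat.ceil_lt_add_one (div_nonneg (Real.log_nonneg hX) hl.le)
    have h2 := Real.log_le_rpow_div hX0.le hε
    have h3 := Real.one_le_rpow hX hε.le
    have h4 : Real.log X / Real.log 2 ≤ 1 / (ε * Real.log 2) * X ^ ε := by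
      rw [div_le_iff₀ hl]
      refine h2.trans (le_of_eq ?_)
      field_simp
    linarith

theorem sq_unique_aux (a b : ℕ) (d e : ℤ) (hab : a.Coprime b) (he : Squarefree e)
    (h : d * (a : ℤ) ^ 2 = e * (b : ℤ) ^ 2) : a = 1 := by
  have h1 : (a : ℤ) ^ 2 ∣ e * (b : ℤ) ^ 2 := ⟨d, by rw [← h]; ring⟩
  have h2 : (a : ℤ) ^ 2 ∣ e := (hab.isCoprime.pow).dvd_of_dvd_mul_right h1
  have h3 := he a (by rwa [← sq])
  exact Nat.isUnit_iff.mp (by simpa [Int.isUnit_iff_natAbs_eq] using h3)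

theorem sq_unique (n n' : ℕ) (d e : ℤ) (hn : 0 < n) (hd : Squarefree d) (he : Squarefree e)
    (h : d * (n : ℤ) ^ 2 = e * (n' : ℤ) ^ 2) : d = e ∧ n = n' := by
  obtain ⟨a, b, hab, ha, hb⟩ := Nat.exists_coprime n n'
  have hg : 0 < n.gcd n' := Nat.gcd_pos_of_pos_left _ hn
  have hg' : ((n.gcd n' : ℕ) : ℤ) ^ 2 ≠ 0 := by positivity
  have h' : d * (a : ℤ) ^ 2 = e * (b : ℤ) ^ 2 := by
    have h1 : (n : ℤ) = a * (n.gcd n' : ℕ) := by exact_mod_cast ha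
    have h2 : (n' : ℤ) = b * (n.gcd n' : ℕ) := by exact_mod_cast hb
    apply mul_right_cancel₀ hg'
    calc _ = d * (a * (n.gcd n' : ℕ) : ℤ) ^ 2 := by ring
      _ = e * (b * (n.gcd n' : ℕ) : ℤ) ^ 2 := by rw [← h1, ← h2, h]
      _ = _ := by ring
  have ha1 := sq_unique_aux a b d e hab he h'
  have hb1 := sq_unique_aux b a e d hab.symm hd h'.symm
  subst ha1 hb1
  refine ⟨by simpa using h', ?_⟩
  rw [ha, ← hb]

theorem mem_As_iff (N : ℕ) (hN : 0 < N) (m : ℤ) :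
    m ∈ As N.primeFactors ↔ m ≠ 0 ∧ Int.gcd m N = 1 := by
  unfold As
  refine and_congr_right fun hm => ?_
  constructor
  · intro h
    by_contra hne
    obtain ⟨q, hq, hqd⟩ := Nat.exists_prime_and_dvd hne
    have h1 : (q : ℤ) ∣ m := (Int.natCast_dvd_natCast.mpr hqd).trans (Int.gcd_dvd_left _ _)
    have h2 : (q : ℤ) ∣ N := (Int.natCast_dvd_natCast.mpr hqd).trans (Int.gcd_dvd_right _ _)
    exact h q (Nat.mem_primeFactors.mpr ⟨hq, by exact_mod_cast h2, hN.ne'⟩) h1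
  · intro h q hq hqm
    have hq' := Nat.mem_primeFactors.mp hq
    have : (q : ℤ) ∣ (Int.gcd m N : ℕ) := Int.dvd_coe_gcd hqm (by exact_mod_cast hq'.2.1)
    rw [h] at this
    exact hq'.1.one_lt.ne' (by simpa using (show q ∣ 1 by exact_mod_cast this))

theorem wtilde_sum (w : SchwartzMap ℝ ℝ) (N : ℕ) (hN : 0 < N) (X : ℝ) (hX : 0 < X)
    (P : ℤ → Prop) (A : Set ℤ) (hA0 : A ⊆ As N.primeFactors)
    (hA : ∀ d : ℤ, Squarefree d → ∀ n : ℕ, 0 < n →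
      (d * (n : ℤ) ^ 2 ∈ A ↔ d * (n : ℤ) ^ 2 ∈ As N.primeFactors ∧ P d)) :
    (∑' d : ℤ, if Squarefree d ∧ Int.gcd d N = 1 ∧ P d
      then wtilde (⇑w) N ((d : ℝ) / X) else 0) = TA w A X := by
  set F : ℤ → ℝ := A.indicator (fun m : ℤ => w ((m : ℝ) / X)) with hF
  have hFs : Summable F := TA_summable w A (fun h => zero_notMem_As _ (hA0 h)) X hX
  set T : Set (ℤ × ℕ) := {x | Squarefree x.1 ∧ 0 < x.2} with hT
  set g : ℤ × ℕ → ℤ := fun x => x.1 * (x.2 : ℤ) ^ 2 with hg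
  have hinj : Function.Injective (fun t : T => g t) := by
    rintro ⟨⟨d, n⟩, hd, hn⟩ ⟨⟨e, n'⟩, he, hn'⟩ h
    obtain ⟨rfl, rfl⟩ := sq_unique n n' d e hn hd he h
    rfl
  have hrange : Function.support F ⊆ Set.range (fun t : T => g t) := by
    intro m hm
    have hm0 : m ≠ 0 := (hA0 (Set.mem_of_indicator_ne_zero hm)).1
    obtain ⟨a, b, hab, ha⟩ := Nat.sq_mul_squarefree m.natAbs
    have hb : 0 < b := by
      rcases Nat.eq_zero_or_pos b with rfl | h
      · exact absurd hab.symm (by simpa using hm0)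
      · exact h
    refine ⟨⟨(m.sign * a, b), ?_, hb⟩, ?_⟩
    · rw [← Int.squarefree_natAbs, Int.natAbs_mul, Int.natAbs_sign_of_ne_zero hm0]
      simpa using ha
    · change m.sign * a * (b : ℤ) ^ 2 = m
      have : ((b : ℤ) ^ 2 * a) = m.natAbs := by exact_mod_cast hab
      calc _ = m.sign * ((b : ℤ) ^ 2 * a) := by ring
        _ = m := by rw [this]; exact Int.sign_mul_natAbs m
  have h1 : TA w A X = ∑' t : T, F (g t) := (hinj.tsum_eq hrange).symm
  have h2 : Summable (fun t : T => F (g t)) := hFs.comp_injective hinj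
  have h3 : Summable (T.indicator (fun x => F (g x))) := summable_subtype_iff_indicator.mp h2
  rw [h1, tsum_subtype T (fun x => F (g x)), h3.tsum_prod]
  congr 1
  ext d
  by_cases hd : Squarefree d ∧ Int.gcd d N = 1 ∧ P d
  · rw [if_pos hd]
    unfold wtilde
    congr 1
    ext n
    by_cases hn : 0 < n
    · rw [Set.indicator_of_mem (show (d, n) ∈ T from ⟨hd.1, hn⟩)]
      have hmem : g (d, n) ∈ A ↔ Nat.Coprime n N := by
        rw [hg, hA d hd.1 n hn, mem_As_iff N hN]
        have hne : d * (n : ℤ) ^ 2 ≠ 0 := mul_ne_zero hd.1.ne_zero (by positivity)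
        simp only [hne, ne_eq, not_false_eq_true, true_and, hd.2.2, and_true]
        rw [← Int.isCoprime_iff_gcd_eq_one, IsCoprime.mul_left_iff,
          IsCoprime.pow_left_iff (by norm_num), Nat.isCoprime_iff_coprime]
        exact and_iff_right (Int.isCoprime_iff_gcd_eq_one.mpr hd.2.1)
      by_cases hc : Nat.Coprime n N
      · rw [if_pos ⟨hn, hc⟩, hF, Set.indicator_of_mem (hmem.mpr hc)]
        congr 1
        simp only [hg]
        push_cast
        ring
      · rw [if_neg (fun h => hc h.2), hF, Set.indicator_of_notMem (fun h => hc (hmem.mp h))]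
    · rw [if_neg (fun h => hn h.1), Set.indicator_of_notMem (fun h => hn h.2)]
  · rw [if_neg hd]
    symm
    convert tsum_zero with n
    by_cases hT' : (d, n) ∈ T
    · rw [Set.indicator_of_mem hT', hF, Set.indicator_of_notMem]
      intro h
      obtain ⟨ha, hP⟩ := (hA d hT'.1 n hT'.2).mp h
      refine hd ⟨hT'.1, ?_, hP⟩
      have := ((mem_As_iff N hN _).mp ha).2
      rw [← Int.isCoprime_iff_gcd_eq_one, IsCoprime.mul_left_iff] at this
      exact Int.isCoprime_iff_gcd_eq_one.mp this.1
    · rw [Set.indicator_of_notMem hT']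

theorem odd_val_iff (p : ℕ) (hp : p.Prime) (d : ℤ) (hd : Squarefree d) (n : ℕ) (hn : 0 < n) :
    Odd (padicValInt p (d * (n : ℤ) ^ 2)) ↔ (p : ℤ) ∣ d := by
  have := Fact.mk hp
  have hn' : (n : ℤ) ≠ 0 := by positivity
  rw [padicValInt.mul hd.ne_zero (by positivity), sq, padicValInt.mul hn' hn', Nat.odd_add]
  rw [iff_true_right (Even.add_self _)]
  constructor
  · intro ho
    by_contra hnd
    rw [padicValInt.eq_zero_of_not_dvd hnd] at ho
    exact absurd ho (by decide)
  · rintro ⟨k, rfl⟩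
    have hp' : (p : ℤ) ≠ 0 := by exact_mod_cast hp.ne_zero
    have hk : ¬ (p : ℤ) ∣ k := by
      intro hk
      have := hd p (mul_dvd_mul_left _ hk)
      exact (Nat.prime_iff_prime_int.mp hp).not_isUnit this
    rw [padicValInt.mul hp' (right_ne_zero_of_mul hd.ne_zero), padicValInt.self hp.one_lt,
      padicValInt.eq_zero_of_not_dvd hk]
    decide

/-- The weighted count of squarefree `d` coprime to `N` divisible by a prime
`p`: it is `W(X)/(p+1) + O_{ε,w}((p²XN)^ε)` if `p ∤ N`, and `0` if `p ∣ N`. -/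
theorem weighted_count_divisible_by_p (w : SchwartzMap ℝ ℝ)
    (heven : ∀ x : ℝ, w (-x) = w x) :
    ∀ ε : ℝ, 0 < ε → ∃ C : ℝ, 0 < C ∧
      ∀ N : ℕ, 0 < N → ∀ p : ℕ, p.Prime → ∀ X : ℝ, 1 ≤ X →
        (¬ p ∣ N →
          |(∑' d : ℤ, if Squarefree d ∧ Int.gcd d N = 1 ∧ (p : ℤ) ∣ d
                then wtilde (⇑w) N ((d : ℝ) / X) else 0)
              - (∑' d : ℤ, if Squarefree d ∧ Int.gcd d N = 1
                  then wtilde (⇑w) N ((d : ℝ) / X) else 0) / ((p : ℝ) + 1)|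
            ≤ C * ((p : ℝ) ^ 2 * X * (N : ℝ)) ^ ε) ∧
        (p ∣ N →
          (∑' d : ℤ, if Squarefree d ∧ Int.gcd d N = 1 ∧ (p : ℤ) ∣ d
              then wtilde (⇑w) N ((d : ℝ) / X) else 0) = 0) := by
  intro ε hε
  obtain ⟨D, hD, hE⟩ := E_bound w
  obtain ⟨C1, hC1, h1⟩ := two_pow_omega ε hε
  obtain ⟨C2, hC2, h2⟩ := log_part ε hε
  refine ⟨D * C1 * C2, by positivity, fun N hN p hp X hX => ⟨fun hpN => ?_, fun hpN => ?_⟩⟩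
  · have hX0 : 0 < X := by linarith
    have e1 := wtilde_sum w N hN X hX0 (fun d => (p : ℤ) ∣ d) (Bs N.primeFactors p)
      (fun m hm => hm.1) (fun d hd n hn => and_congr_right fun _ => odd_val_iff p hp d hd n hn)
    have e2 := wtilde_sum w N hN X hX0 (fun _ => True) (As N.primeFactors)
      (fun m hm => hm) (fun d hd n hn => by simp)
    simp only [and_true] at e2
    have e1' : (∑' d : ℤ, if Squarefree d ∧ Int.gcd d N = 1 ∧ (p : ℤ) ∣ d
        then wtilde (⇑w) N ((d : ℝ) / X) else 0) = TA w (Bs N.primeFactors p) X := by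
      convert e1
    have e2' : (∑' d : ℤ, if Squarefree d ∧ Int.gcd d N = 1
        then wtilde (⇑w) N ((d : ℝ) / X) else 0) = TA w (As N.primeFactors) X := by
      convert e2
    rw [e1', e2']
    obtain ⟨k, hk, hk2⟩ := h2 X hX
    refine (hE N.primeFactors (fun r hr => Nat.prime_of_mem_primeFactors hr) p hp
      (fun h => hpN (Nat.dvd_of_mem_primeFactors h)) k X hX0 hk).trans ?_
    have hN1 : (1 : ℝ) ≤ N := by exact_mod_cast hN
    have hp1 : (1 : ℝ) ≤ (p : ℝ) ^ 2 := one_le_pow₀ (by exact_mod_cast hp.one_le)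
    calc D * 2 ^ N.primeFactors.card * ((k : ℝ) + 2)
        ≤ D * (C1 * (N : ℝ) ^ ε) * (C2 * X ^ ε) := by
          gcongr
          exact h1 N hN
      _ = D * C1 * C2 * (X * (N : ℝ)) ^ ε := by
          rw [Real.mul_rpow hX0.le (by positivity)]
          ring
      _ ≤ _ := by
          gcongr
          nlinarith
  · convert tsum_zero with d
    rw [if_neg]
    rintro ⟨_, hg, hpd⟩
    have : (p : ℤ) ∣ (Int.gcd d N : ℕ) := Int.dvd_coe_gcd hpd (by exact_mod_cast hpN)
    rw [hg] at this
    exact hp.one_lt.ne' (by simpa using (show p ∣ 1 by exact_mod_cast this))
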